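/- Let G be a connected graph and G' a connected induced subgraph of G. If mtd(G) is even then mtd(G') ≤ mtd(G); if mtd(G) is odd then mtd(G') ≤ mtd(G) + 1. -/

import Mathlib

open SimpleGraph

/-- An elimination tree (forest) of a graph `G`, encoded via its strict
ancestor relation `anc`: ancestors of each vertex form a chain, every edge of
`G` joins comparable vertices, and the vertex set of every subtree induces a
connected subgraph (so the subtrees of any node are exactly the connected
components left after deleting the node and its ancestors, as in the
recursive definition). -/
structure ElimTree {V : Type} (G : SimpleGraph V) where
  anc : V → V → Prop
  trans : ∀ a b c, anc a b → anc b c → anc a c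
  irrefl : ∀ a, ¬ anc a a
  chainAnc : ∀ a b c, anc a c → anc b c → a = b ∨ anc a b ∨ anc b a
  edgeComp : ∀ u v, G.Adj u v → anc u v ∨ anc v u
  subtreeConn : ∀ v, (G.induce {w | w = v ∨ anc v w}).Connected

/-- Depth: maximum number of vertices on a root-to-leaf path. -/
noncomputable def ElimTree.depth {V : Type} [Fintype V] {G : SimpleGraph V}
    (T : ElimTree G) : ℕ :=
  Finset.univ.sup fun v => {u | T.anc u v}.ncard + 1

/-- Treedepth: minimum depth of an elimination tree. -/
noncomputable def treedepth {V : Type} [Fintype V] (G : SimpleGraph V) : ℕ :=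
  sInf {d | ∃ T : ElimTree G, T.depth = d}

/-- The matched condition on a root-to-leaf path `(v₁, …, v_k)` (as a list):
if `k` is even, the pairs `v₁v₂, v₃v₄, …, v_{k-1}v_k` are edges (a matching);
if `k` is odd, there is a position `p` (0-based, odd) such that consecutive
pairs form edges, with the vertex at position `p` used twice. -/
def MatchedList {V : Type} (G : SimpleGraph V) (l : List V) : Prop :=
  (Even l.length ∧ ∀ (j : ℕ) (h : 2 * j + 1 < l.length),
      G.Adj (l.get ⟨2 * j, by omega⟩) (l.get ⟨2 * j + 1, h⟩)) ∨
  (Odd l.length ∧ ∃ p : ℕ, Odd p ∧ ∃ _hp : p + 1 < l.length,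
      (∀ (j : ℕ) (_h : 2 * j + 1 ≤ p),
        G.Adj (l.get ⟨2 * j, by omega⟩) (l.get ⟨2 * j + 1, by omega⟩)) ∧
      (∀ (b : ℕ) (h : p + 2 * b + 1 < l.length),
        G.Adj (l.get ⟨p + 2 * b, by omega⟩) (l.get ⟨p + 2 * b + 1, h⟩)))

/-- A matched elimination tree: every root-to-leaf path (enumerated in order
from the root) satisfies the matched condition. -/
def ElimTree.IsMatched {V : Type} {G : SimpleGraph V} (T : ElimTree G) : Prop :=
  ∀ v : V, (∀ w, ¬ T.anc v w) →
    ∀ l : List V, l.Pairwise T.anc → (∀ u, u ∈ l ↔ (T.anc u v ∨ u = v)) →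
      MatchedList G l

/-- Matched treedepth: minimum depth of a matched elimination tree. -/
noncomputable def mtd {V : Type} [Fintype V] (G : SimpleGraph V) : ℕ :=
  sInf {d | ∃ T : ElimTree G, T.IsMatched ∧ T.depth = d}

/-- Reachability by a walk all of whose steps stay in `A`. -/
def ReachIn {W : Type} (G : SimpleGraph W) (A : Set W) : W → W → Prop :=
  Relation.ReflTransGen fun a b => G.Adj a b ∧ a ∈ A ∧ b ∈ A

/-- Any two vertices of `A` are joined by a walk inside `A`. -/
def ConnIn {W : Type} (G : SimpleGraph W) (A : Set W) : Prop :=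
  ∀ a ∈ A, ∀ b ∈ A, ReachIn G A a b

/-- `C` is the vertex set of a connected component of the subgraph induced on `A`. -/
def IsComp {W : Type} (G : SimpleGraph W) (A C : Set W) : Prop :=
  ∃ c ∈ A, C = {w | ReachIn G A c w}

theorem ReachIn.symm {W : Type} {G : SimpleGraph W} {A : Set W} {a b : W}
    (h : ReachIn G A a b) : ReachIn G A b a := by
  induction h with
  | refl => exact .refl
  | tail _ h ih => exact .head ⟨h.1.symm, h.2.2, h.2.1⟩ ih

theorem ReachIn.mem {W : Type} {G : SimpleGraph W} {A : Set W} {a b : W}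
    (h : ReachIn G A a b) (ha : a ∈ A) : b ∈ A := by
  induction h with
  | refl => exact ha
  | tail _ h ih => exact h.2.2

theorem ReachIn.in_comp {W : Type} {G : SimpleGraph W} {A : Set W} {a b : W}
    (h : ReachIn G A a b) : ReachIn G {w | ReachIn G A a w} a b := by
  induction h with
  | refl => exact .refl
  | tail hab h ih => exact ih.tail ⟨h.1, hab, Relation.ReflTransGen.tail hab h⟩

theorem IsComp.connIn {W : Type} {G : SimpleGraph W} {A C : Set W} (h : IsComp G A C) :
    ConnIn G C := by
  obtain ⟨c, _, rfl⟩ := h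
  exact fun a ha b hb => ha.in_comp.symm.trans hb.in_comp

theorem IsComp.subset {W : Type} {G : SimpleGraph W} {A C : Set W} (h : IsComp G A C) :
    C ⊆ A := by
  obtain ⟨c, hc, rfl⟩ := h
  exact fun w hw => ReachIn.mem hw hc

theorem IsComp.nonempty {W : Type} {G : SimpleGraph W} {A C : Set W} (h : IsComp G A C) :
    C.Nonempty := by
  obtain ⟨c, hc, rfl⟩ := h
  exact ⟨c, .refl⟩

theorem IsComp.eq_of_mem {W : Type} {G : SimpleGraph W} {A C : Set W} (h : IsComp G A C)
    {u : W} (hu : u ∈ C) : C = {w | ReachIn G A u w} := by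
  obtain ⟨c, hc, rfl⟩ := h
  ext w
  exact ⟨fun hw => (ReachIn.symm hu).trans hw, fun hw => Relation.ReflTransGen.trans hu hw⟩

/-- In a connected set, each component left after deleting `x` has a neighbour of `x`. -/
theorem IsComp.exists_adj {W : Type} {G : SimpleGraph W} {H C : Set W} {x : W}
    (hH : ConnIn G H) (hx : x ∈ H) (hC : IsComp G (H \ {x}) C) : ∃ y ∈ C, G.Adj x y := by
  obtain ⟨c, hc, rfl⟩ := hC
  have key : ∀ w, ReachIn G H x w → w = x ∨ ∃ y, G.Adj x y ∧ ReachIn G (H \ {x}) y w := by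
    intro w hw
    induction hw with
    | refl => exact .inl rfl
    | @tail w w' _ h ih =>
      by_cases hw' : w' = x
      · exact .inl hw'
      · by_cases hw : w = x
        · exact .inr ⟨w', hw ▸ h.1, .refl⟩
        · obtain ⟨y, hy, hyw⟩ := ih.resolve_left hw
          exact .inr ⟨y, hy, hyw.tail ⟨h.1, ⟨h.2.1, hw⟩, ⟨h.2.2, hw'⟩⟩⟩
  obtain ⟨y, hy, hyc⟩ := (key c (hH x hx c hc.1)).resolve_left hc.2
  exact ⟨y, hyc.symm, hy⟩

theorem ConnIn.induce_connected {W : Type} {G : SimpleGraph W} {A : Set W}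
    (h : ConnIn G A) (hA : A.Nonempty) : (G.induce A).Connected := by
  have key : ∀ a b (ha : a ∈ A), ReachIn G A a b →
      ∃ hb : b ∈ A, (G.induce A).Reachable ⟨a, ha⟩ ⟨b, hb⟩ := by
    intro a b ha hab
    induction hab with
    | refl => exact ⟨ha, .refl _⟩
    | tail _ h ih =>
      obtain ⟨hb, hr⟩ := ih
      refine ⟨h.2.2, hr.trans (SimpleGraph.Adj.reachable ?_)⟩
      simpa using h.1
  have := hA.to_subtype
  exact ⟨fun a b => (key a b a.2 (h a a.2 b b.2)).2⟩

theorem SimpleGraph.Connected.connIn_univ {W : Type} {G : SimpleGraph W} (h : G.Connected) :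
    ConnIn G Set.univ := by
  intro a _ b _
  obtain ⟨p⟩ := h.preconnected a b
  induction p with
  | nil => exact .refl
  | cons h _ ih => exact .head ⟨h, trivial, trivial⟩ (ih trivial trivial)

/-- The connected set `H` can be eliminated in `n` rounds, each of which deletes a vertex and
then, in every remaining component, a neighbour of that vertex. -/
def EdgeElim {W : Type} (G : SimpleGraph W) : ℕ → Set W → Prop
  | 0, _ => False
  | n + 1, H => ∃ x ∈ H, ∀ C, IsComp G (H \ {x}) C → ∃ y ∈ C, G.Adj x y ∧
      ∀ C', IsComp G (C \ {y}) C' → EdgeElim G n C'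

theorem EdgeElim.succ {W : Type} {G : SimpleGraph W} {n : ℕ} {H : Set W}
    (h : EdgeElim G n H) : EdgeElim G (n + 1) H := by
  induction n generalizing H with
  | zero => exact h.elim
  | succ n ih =>
    obtain ⟨x, hx, h⟩ := h
    refine ⟨x, hx, fun C hC => ?_⟩
    obtain ⟨y, hy, hxy, h⟩ := h C hC
    exact ⟨y, hy, hxy, fun C' hC' => ih (h C' hC')⟩

theorem edgeElim_of_ncard_le {W : Type} [Finite W] {G : SimpleGraph W} (n : ℕ) (H : Set W)
    (hn : H.ncard ≤ n) (hne : H.Nonempty) (hH : ConnIn G H) : EdgeElim G n H := by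
  induction n generalizing H with
  | zero => exact absurd ((Set.ncard_pos).2 hne) (by omega)
  | succ n ih =>
    obtain ⟨x, hx⟩ := hne
    refine ⟨x, hx, fun C hC => ?_⟩
    obtain ⟨y, hy, hxy⟩ := hC.exists_adj hH hx
    refine ⟨y, hy, hxy, fun C' hC' => ih C' ?_ hC'.nonempty hC'.connIn⟩
    have h₁ : C' ⊆ H \ {x} := fun w hw => hC.subset (hC'.subset hw).1
    have h₂ := Set.ncard_le_ncard h₁
    have h₃ := Set.ncard_sdiff_singleton_add_one hx
    omega

namespace ElimTree

variable {V : Type} {G : SimpleGraph V} (T : ElimTree G)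

/-- `u` is `v` or an ancestor of `v`. -/
def Le (u v : V) : Prop := v = u ∨ T.anc u v

/-- `y` is a child of `x`. -/
def Child (x y : V) : Prop := T.anc x y ∧ ∀ u, T.anc u y → u = x ∨ T.anc u x

/-- The number of proper ancestors of `v`. -/
noncomputable def level (v : V) : ℕ := {u | T.anc u v}.ncard

theorem Le.trans {T : ElimTree G} {a b c : V} (h : T.Le a b) (h' : T.Le b c) : T.Le a c := by
  rcases h with rfl | h
  · exact h'
  · rcases h' with rfl | h'
    · exact .inr h
    · exact .inr (T.trans _ _ _ h h')

theorem level_lt [Finite V] {u v : V} (h : T.anc u v) : T.level u < T.level v := by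
  refine Set.ncard_lt_ncard ?_
  refine (Set.ssubset_iff_of_subset fun w hw => T.trans _ _ _ hw h).2 ⟨u, h, T.irrefl u⟩

theorem Child.level_eq [Finite V] {T : ElimTree G} {x y : V} (h : T.Child x y) :
    T.level y = T.level x + 1 := by
  have : {u | T.anc u y} = insert x {u | T.anc u x} := by
    ext u
    refine ⟨fun hu => h.2 u hu, ?_⟩
    rintro (rfl | hu)
    · exact h.1
    · exact T.trans _ _ _ hu h.1
  rw [level, this, Set.ncard_insert_of_notMem (show x ∉ {u | T.anc u x} from T.irrefl x)]
  rfl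

theorem exists_child [Finite V] {x w : V} (h : T.anc x w) : ∃ y, T.Child x y ∧ T.Le y w := by
  obtain ⟨y, ⟨hxy, hyw⟩, hmin⟩ := Set.exists_min_image {u | T.anc x u ∧ T.Le u w} T.level
    (Set.toFinite _) ⟨w, h, .inl rfl⟩
  refine ⟨y, ⟨hxy, fun u hu => ?_⟩, hyw⟩
  rcases T.chainAnc u x y hu hxy with h | h | h
  · exact .inl h
  · exact .inr h
  · have := hmin u ⟨h, Le.trans (.inr hu) hyw⟩
    have := T.level_lt hu
    omega

theorem exists_parent [Finite V] {u v : V} (h : T.anc u v) : ∃ x, T.Child x v := by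
  obtain ⟨x, hx, hmax⟩ := Set.exists_max_image {u | T.anc u v} T.level
    (Set.toFinite _) ⟨u, h⟩
  refine ⟨x, hx, fun u hu => ?_⟩
  rcases T.chainAnc u x v hu hx with h | h | h
  · exact .inl h
  · exact .inr h
  · have := hmax u hu
    have := T.level_lt h
    omega

theorem exists_leaf [Finite V] (x : V) : ∃ v, T.Le x v ∧ ∀ w, ¬ T.anc v w := by
  obtain ⟨v, hv, hmax⟩ := Set.exists_max_image {v | T.Le x v} T.level
    (Set.toFinite _) ⟨x, .inl rfl⟩
  refine ⟨v, hv, fun w hw => ?_⟩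
  have := hmax w (Le.trans hv (.inr hw))
  have := T.level_lt hw
  omega

theorem exists_root [Finite V] (x : V) : ∃ r, ∀ u, ¬ T.anc u r := by
  obtain ⟨r, -, hmin⟩ := Set.exists_min_image Set.univ T.level (Set.toFinite _) ⟨x, trivial⟩
  refine ⟨r, fun u hu => ?_⟩
  have := hmin u trivial
  have := T.level_lt hu
  omega

theorem exists_path [Finite V] (v : V) : ∃ l : List V, l.Pairwise T.anc ∧
    (∀ u, u ∈ l ↔ (T.anc u v ∨ u = v)) ∧ l.length = T.level v + 1 ∧
    ∀ (i : ℕ) (h : i < l.length), T.level l[i] = i := by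
  induction hn : T.level v generalizing v with
  | zero =>
    have h0 : ∀ u, ¬ T.anc u v := fun u hu => by
      have := T.level_lt hu
      omega
    refine ⟨[v], by simp, by simp [h0], by simp, ?_⟩
    intro i h
    obtain rfl : i = 0 := by simpa using h
    simpa using hn
  | succ n ih =>
    obtain ⟨u, hu⟩ : {u | T.anc u v}.Nonempty := by
      refine Set.nonempty_of_ncard_ne_zero ?_
      change T.level v ≠ 0
      omega
    obtain ⟨x, hx⟩ := T.exists_parent hu
    have hlev := hx.level_eq
    obtain ⟨l, hp, hm, hl, hi⟩ := ih x (by omega)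
    refine ⟨l ++ [v], ?_, ?_, by simp [hl], ?_⟩
    · rw [List.pairwise_append]
      refine ⟨hp, by simp, fun a ha b hb => ?_⟩
      obtain rfl : b = v := by simpa using hb
      rcases (hm a).1 ha with h | rfl
      · exact T.trans _ _ _ h hx.1
      · exact hx.1
    · intro u
      simp only [List.mem_append, hm, List.mem_singleton]
      refine or_congr_left ⟨?_, fun h => (hx.2 u h).symm⟩
      rintro (h | rfl)
      · exact T.trans _ _ _ h hx.1
      · exact hx.1
    · intro i h
      rcases Nat.lt_or_ge i l.length with h' | h'
      · rw [List.getElem_append_left h', hi]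
      · have : i = l.length := by
          simp at h
          omega
        subst this
        simp [hn, hl]

/-- The matching condition on a root-to-leaf path, expressed through levels. -/
theorem IsMatched.leaf [Finite V] {T : ElimTree G} (hT : T.IsMatched) {v : V}
    (hv : ∀ w, ¬ T.anc v w) :
    (∀ a b, T.Child a b → T.Le b v → Even (T.level a) → G.Adj a b) ∨
    (Even (T.level v) ∧ ∃ p, ∀ a b, T.Child a b → T.Le b v →
      (Even (T.level a) → T.level a < p → G.Adj a b) ∧
      (Odd (T.level a) → p ≤ T.level a → G.Adj a b)) := by
  obtain ⟨l, hp, hm, hl, hi⟩ := T.exists_path v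
  have get : ∀ u, T.Le u v → ∃ h : T.level u < l.length, l[T.level u] = u := by
    intro u hu
    have : u ∈ l := (hm u).2 (hu.symm.imp id Eq.symm)
    obtain ⟨i, h, rfl⟩ := List.mem_iff_getElem.1 this
    have := hi i h
    exact ⟨by omega, by simp only [this]⟩
  have pair : ∀ a b, T.Child a b → T.Le b v → ∃ h : T.level a + 1 < l.length,
      l[T.level a] = a ∧ l[T.level a + 1] = b := by
    intro a b hab hb
    obtain ⟨h₁, e₁⟩ := get a (Le.trans (.inr hab.1) hb)
    obtain ⟨h₂, e₂⟩ := get b hb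
    have := hab.level_eq
    simp only [this] at h₂ e₂
    exact ⟨h₂, e₁, e₂⟩
  rcases hT v hv l hp hm with ⟨-, h⟩ | ⟨hodd, p, hpo, hpl, h₁, h₂⟩
  · left
    intro a b hab hb he
    obtain ⟨hlt, ha, hb⟩ := pair a b hab hb
    obtain ⟨j, hj⟩ := he.exists_two_nsmul
    simp only [smul_eq_mul] at hj
    have := h j (by omega)
    simp only [List.get_eq_getElem, ← hj, ha, hb] at this
    exact this
  · right
    refine ⟨by rw [hl] at hodd; grind, p, fun a b hab hb => ?_⟩
    obtain ⟨hlt, ha, hb⟩ := pair a b hab hb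
    constructor
    · intro he hlp
      obtain ⟨j, hj⟩ := he.exists_two_nsmul
      simp only [smul_eq_mul] at hj
      have := h₁ j (by omega)
      simp only [List.get_eq_getElem, ← hj, ha, hb] at this
      exact this
    · intro ho hlp
      obtain ⟨k, hk⟩ : ∃ k, T.level a = p + 2 * k := by
        obtain ⟨s, hs⟩ := ho
        obtain ⟨t, ht⟩ := hpo
        exact ⟨s - t, by omega⟩
      have := h₂ k (by omega)
      simp only [List.get_eq_getElem, ← hk, ha, hb] at this
      exact this

/-- The subtree at a node can be eliminated in `n` rounds, each of which either uses an edge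
from the node to a child or discards the node alone. -/
def Rounds : ℕ → V → Prop
  | 0, _ => False
  | n + 1, x => ∀ y, T.Child x y →
      (G.Adj x y ∧ ∀ z, T.Child y z → Rounds n z) ∨ Rounds n y

theorem rounds_of_odd_level [Finite V] {m : ℕ} (hm : ∀ v, T.level v + 1 ≤ 2 * m) (n : ℕ) (y : V)
    (hy : T.level y + 1 + 2 * n = 2 * m)
    (h : ∀ v, (∀ w, ¬ T.anc v w) → T.Le y v → Even (T.level v) ∧
      ∀ a b, T.Child a b → T.Le b v → Odd (T.level a) → T.level y ≤ T.level a → G.Adj a b) :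
    T.Rounds n y := by
  induction n generalizing y with
  | zero =>
    obtain ⟨v, hyv, hv⟩ := T.exists_leaf y
    obtain ⟨k, hk⟩ := (h v hv hyv).1
    have := hm v
    rcases hyv with rfl | hyv
    · omega
    · have := T.level_lt hyv
      omega
  | succ n ih =>
    intro z hz
    left
    constructor
    · obtain ⟨v, hzv, hv⟩ := T.exists_leaf z
      exact (h v hv (Le.trans (.inr hz.1) hzv)).2 y z hz hzv ⟨m - n - 2, by omega⟩ le_rfl
    · intro w hw
      have h₁ := hz.level_eq
      have h₂ := hw.level_eq
      refine ih w (by omega) fun v hv hwv => ?_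
      obtain ⟨he, ha⟩ := h v hv (Le.trans (.inr hz.1) (Le.trans (.inr hw.1) hwv))
      exact ⟨he, fun a b hab hb ho hle => ha a b hab hb ho (by omega)⟩

theorem IsMatched.rounds [Finite V] {T : ElimTree G} (hT : T.IsMatched) {m : ℕ}
    (hm : ∀ v, T.level v + 1 ≤ 2 * m) (n : ℕ) (x : V) (hx : T.level x + 2 * n = 2 * m) :
    T.Rounds n x := by
  induction n generalizing x with
  | zero =>
    have := hm x
    omega
  | succ n ih =>
    intro y hy
    have hxy := hy.level_eq
    by_cases hadj : G.Adj x y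
    · refine .inl ⟨hadj, fun z hz => ih z ?_⟩
      have := hz.level_eq
      omega
    · right
      have hxe : Even (T.level x) := ⟨m - n - 1, by omega⟩
      refine T.rounds_of_odd_level hm n y (by omega) fun v hv hyv => ?_
      rcases hT.leaf hv with h | ⟨he, p, h⟩
      · exact absurd (h x y hy hyv hxe) hadj
      · refine ⟨he, fun a b hab hb ho hle => (h a b hab hb).2 ho ?_⟩
        have : ¬ T.level x < p := fun hlt => hadj ((h x y hy hyv).1 hxe hlt)
        omega

variable {W : Type} {G' : SimpleGraph W}

/-- A walk avoiding all proper ancestors of `y` cannot leave the subtree at `y`. -/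
theorem le_of_reachIn (f : G' ↪g G) {A : Set W} {y : V} (hA : ∀ a ∈ A, ¬ T.anc (f a) y) {u w : W}
    (h : ReachIn G' A u w) (hu : T.Le y (f u)) : T.Le y (f w) := by
  induction h with
  | refl => exact hu
  | @tail b c _ h ih =>
    rcases T.edgeComp _ _ (f.map_adj_iff.2 h.1) with hbc | hcb
    · exact Le.trans ih (.inr hbc)
    · rcases ih with h' | h'
      · exact absurd (h' ▸ hcb) (hA c h.2.2)
      · rcases T.chainAnc _ _ _ hcb h' with e | e | e
        · exact .inl e
        · exact absurd e (hA c h.2.2)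
        · exact .inr e

theorem exists_child_le [Finite V] (f : G' ↪g G) {H : Set W} {t : V} (hH : ConnIn G' H)
    (hne : H.Nonempty) (ht : ∀ a ∈ H, T.anc t (f a)) : ∃ s, T.Child t s ∧ ∀ a ∈ H, T.Le s (f a) := by
  obtain ⟨c, hc⟩ := hne
  obtain ⟨s, hs, hsc⟩ := T.exists_child (ht c hc)
  refine ⟨s, hs, fun a ha => T.le_of_reachIn f ?_ (hH c hc a ha) hsc⟩
  intro b hb hbs
  rcases hs.2 _ hbs with e | e
  · exact T.irrefl t (e ▸ ht b hb)
  · exact T.irrefl t (T.trans _ _ _ (ht b hb) e)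

theorem Rounds.edgeElim [Finite V] {T : ElimTree G} {n : ℕ} {t : V} (ht : T.Rounds n t)
    (f : G' ↪g G) {H : Set W} (hH : ConnIn G' H) (hne : H.Nonempty) (hle : ∀ a ∈ H, T.Le t (f a)) :
    EdgeElim G' n H := by
  induction n generalizing t H with
  | zero => exact ht.elim
  | succ n ih =>
    by_cases hex : ∃ a ∈ H, f a = t
    · obtain ⟨a, ha, rfl⟩ := hex
      refine ⟨a, ha, fun C hC => ?_⟩
      obtain ⟨s, hs, hCs⟩ := T.exists_child_le f (t := f a) hC.connIn hC.nonempty fun c hc =>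
        (hle c (hC.subset hc).1).resolve_left fun e => (hC.subset hc).2 (f.injective e)
      obtain ⟨b, hb, hab⟩ := hC.exists_adj hH ha
      rcases ht s hs with ⟨hadj, hz⟩ | hQ
      · obtain ⟨b, hb, hab, hbs⟩ : ∃ b ∈ C, G'.Adj a b ∧ ∀ c ∈ C \ {b}, T.anc s (f c) := by
          by_cases hex : ∃ b ∈ C, f b = s
          · obtain ⟨b, hb, rfl⟩ := hex
            exact ⟨b, hb, f.map_adj_iff.1 hadj, fun c hc =>
              (hCs c hc.1).resolve_left fun e => hc.2 (f.injective e)⟩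
          · exact ⟨b, hb, hab, fun c hc => (hCs c hc.1).resolve_left fun e => hex ⟨c, hc.1, e⟩⟩
        refine ⟨b, hb, hab, fun C' hC' => ?_⟩
        obtain ⟨z, hsz, hCz⟩ := T.exists_child_le f hC'.connIn hC'.nonempty fun c hc =>
          hbs c (hC'.subset hc)
        exact ih (hz z hsz) hC'.connIn hC'.nonempty hCz
      · exact ⟨b, hb, hab, fun C' hC' => ih hQ hC'.connIn hC'.nonempty fun c hc =>
          hCs c (hC'.subset hc).1⟩
    · obtain ⟨s, hs, hHs⟩ := T.exists_child_le f hH hne fun c hc =>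
        (hle c hc).resolve_left fun e => hex ⟨c, hc, e⟩
      rcases ht s hs with ⟨-, hz⟩ | hQ
      · by_cases hex : ∃ b ∈ H, f b = s
        · obtain ⟨b, hb, rfl⟩ := hex
          refine ⟨b, hb, fun C hC => ?_⟩
          obtain ⟨c, hc, hbc⟩ := hC.exists_adj hH hb
          obtain ⟨z, hsz, hCz⟩ := T.exists_child_le f (t := f b) hC.connIn hC.nonempty
            fun c hc => (hHs c (hC.subset hc).1).resolve_left
              fun e => (hC.subset hc).2 (f.injective e)
          exact ⟨c, hc, hbc, fun C' hC' => ih (hz z hsz) hC'.connIn hC'.nonempty fun c hc =>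
            hCz c (hC'.subset hc).1⟩
        · obtain ⟨z, hsz, hHz⟩ := T.exists_child_le f hH hne fun c hc =>
            (hHs c hc).resolve_left fun e => hex ⟨c, hc, e⟩
          exact (ih (hz z hsz) hH hne hHz).succ
      · exact (ih hQ hH hne hHs).succ

theorem IsMatched.edgeElim_univ [Finite V] {T : ElimTree G} (hT : T.IsMatched) (f : G' ↪g G)
    {m : ℕ} (hm : ∀ v, T.level v + 1 ≤ 2 * m) (hG : G.Connected) (hG' : G'.Connected) :
    EdgeElim G' m Set.univ := by
  obtain ⟨r, hr⟩ := T.exists_root hG.nonempty.some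
  have hr0 : T.level r = 0 := by simp [level, hr]
  have hle : ∀ v, T.Le r v := fun v =>
    T.le_of_reachIn Embedding.refl (A := Set.univ) (fun a _ => hr a)
      (hG.connIn_univ r trivial v trivial) (.inl rfl)
  have := hG'.nonempty
  exact (hT.rounds hm m r (by omega)).edgeElim f hG'.connIn_univ Set.univ_nonempty
    fun a _ => hle _

end ElimTree

/-- `P` assigns to each vertex of `H` its root-to-vertex path in an elimination tree of `H`
with depth at most `b` in which all root-to-leaf paths satisfy `good`. -/
structure IsPathSystem {W : Type} (G : SimpleGraph W) (H : Set W) (P : W → List W) (b : ℕ)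
    (good : List W → Prop) : Prop where
  mem : ∀ v ∈ H, ∀ u ∈ P v, u ∈ H
  self : ∀ v ∈ H, v ∈ P v
  trans : ∀ w ∈ H, ∀ v ∈ P w, ∀ u ∈ P v, u ∈ P w
  antisymm : ∀ u ∈ H, ∀ v ∈ H, u ∈ P v → v ∈ P u → u = v
  chain : ∀ c ∈ H, ∀ u ∈ P c, ∀ v ∈ P c, u ∈ P v ∨ v ∈ P u
  pairwise : ∀ v ∈ H, (P v).Pairwise fun u w => u ∈ P w ∧ u ≠ w
  edge : ∀ u ∈ H, ∀ v ∈ H, G.Adj u v → u ∈ P v ∨ v ∈ P u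
  conn : ∀ v ∈ H, ConnIn G {w ∈ H | v ∈ P w}
  length_le : ∀ v ∈ H, (P v).length ≤ b
  leaf : ∀ v ∈ H, (∀ w ∈ H, v ∈ P w → w = v) → good (P v)

theorem IsPathSystem.imp {W : Type} {G : SimpleGraph W} {H : Set W} {P : W → List W} {b : ℕ}
    {good good' : List W → Prop} (h : IsPathSystem G H P b good)
    (hg : ∀ l, good l → good' l) : IsPathSystem G H P b good' :=
  { h with leaf := fun v hv hl => hg _ (h.leaf v hv hl) }

open Classical in
/-- Hanging path systems of the components of `H \ {x}` below `x`. -/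
theorem exists_isPathSystem_of_components {W : Type} {G : SimpleGraph W} {H : Set W} {x : W}
    (hH : ConnIn G H) (hx : x ∈ H) {b : ℕ} {good : Set W → List W → Prop}
    (h : ∀ C, IsComp G (H \ {x}) C → ∃ P, IsPathSystem G C P b (good C)) :
    ∃ P, IsPathSystem G H P (b + 1) fun l => (H = {x} ∧ l = [x]) ∨
      ∃ C l', IsComp G (H \ {x}) C ∧ l = x :: l' ∧ good C l' := by
  choose! Q hQ using h
  obtain ⟨K, hK⟩ : ∃ K : W → Set W, ∀ v, K v = {w | ReachIn G (H \ {x}) v w} := ⟨_, fun _ => rfl⟩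
  have hKc : ∀ v ∈ H, v ≠ x → IsComp G (H \ {x}) (K v) := fun v hv hvx => ⟨v, ⟨hv, hvx⟩, hK v⟩
  have hKs : ∀ v, v ∈ K v := fun v => by rw [hK]; exact .refl
  have hKe : ∀ v ∈ H, v ≠ x → ∀ u ∈ K v, K u = K v := fun v hv hvx u hu => by
    rw [(hKc v hv hvx).eq_of_mem hu, hK]
  have hKH : ∀ v ∈ H, v ≠ x → ∀ u ∈ K v, u ∈ H ∧ u ≠ x := fun v hv hvx u hu =>
    (hKc v hv hvx).subset hu
  obtain ⟨P, hP⟩ : ∃ P : W → List W, ∀ v, P v = if v = x then [x] else x :: Q (K v) v :=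
    ⟨_, fun _ => rfl⟩
  have hPx : P x = [x] := by simp [hP]
  have hPn : ∀ v, v ≠ x → P v = x :: Q (K v) v := fun v hv => by simp [hP, hv]
  have hxP : ∀ v, x ∈ P v := fun v => by
    by_cases hv : v = x <;> simp [hP, hv]
  have hQP : ∀ v ∈ H, v ≠ x → IsPathSystem G (K v) (Q (K v)) b (good (K v)) :=
    fun v hv hvx => hQ _ (hKc v hv hvx)
  have hmem : ∀ v ∈ H, ∀ u, u ∈ P v → u ≠ x →
      v ≠ x ∧ u ∈ Q (K v) v ∧ u ∈ H ∧ K u = K v ∧ u ∈ K v := by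
    intro v hv u hu hux
    have hvx : v ≠ x := by
      rintro rfl
      simp [hPx, hux] at hu
    rw [hPn v hvx, List.mem_cons] at hu
    have hu := hu.resolve_left hux
    have huK := (hQP v hv hvx).mem v (hKs v) u hu
    exact ⟨hvx, hu, (hKH v hv hvx u huK).1, hKe v hv hvx u huK, huK⟩
  have hmem' : ∀ v ∈ H, v ≠ x → ∀ w ∈ K v, ∀ u, u ∈ Q (K v) w → u ∈ P w := by
    intro v hv hvx w hw u hu
    rw [hPn w (hKH v hv hvx w hw).2, hKe v hv hvx w hw]
    exact List.mem_cons_of_mem _ hu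
  refine ⟨P, ?_, ?_, ?_, ?_, ?_, ?_, ?_, ?_, ?_, ?_⟩
  · intro v hv u hu
    by_cases hux : u = x
    · exact hux ▸ hx
    · exact (hmem v hv u hu hux).2.2.1
  · intro v hv
    by_cases hvx : v = x
    · exact hvx ▸ hxP v
    · exact hmem' v hv hvx v (hKs v) v ((hQP v hv hvx).self v (hKs v))
  · intro w hw v hv u hu
    by_cases hux : u = x
    · exact hux ▸ hxP w
    by_cases hvx : v = x
    · subst hvx
      simp [hPx, hux] at hu
    obtain ⟨hwx, hvw, hvH, hKv, hvK⟩ := hmem w hw v hv hvx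
    obtain ⟨-, huv, -, -, -⟩ := hmem v hvH u hu hux
    rw [hKv] at huv
    exact hmem' w hw hwx w (hKs w) u ((hQP w hw hwx).trans w (hKs w) v hvw u huv)
  · intro u hu v hv huv hvu
    by_cases hux : u = x
    · subst hux
      simpa [hPx, eq_comm] using hvu
    obtain ⟨hvx, huv, -, hKu, huK⟩ := hmem v hv u huv hux
    obtain ⟨-, hvu, -, -, -⟩ := hmem u hu v hvu hvx
    rw [hKu] at hvu
    exact (hQP v hv hvx).antisymm u huK v (hKs v) huv hvu
  · intro c hc u hu v hv
    by_cases hux : u = x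
    · exact .inl (hux ▸ hxP v)
    by_cases hvx : v = x
    · exact .inr (hvx ▸ hxP u)
    obtain ⟨hcx, huc, -, -, huK⟩ := hmem c hc u hu hux
    obtain ⟨-, hvc, -, -, hvK⟩ := hmem c hc v hv hvx
    exact ((hQP c hc hcx).chain c (hKs c) u huc v hvc).imp (hmem' c hc hcx v hvK u)
      (hmem' c hc hcx u huK v)
  · intro v hv
    by_cases hvx : v = x
    · subst hvx
      simp [hPx]
    · rw [hPn v hvx, List.pairwise_cons]
      have hm := (hQP v hv hvx).mem v (hKs v)
      refine ⟨fun a ha => ⟨hxP a, (hKH v hv hvx a (hm a ha)).2.symm⟩, ?_⟩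
      exact ((hQP v hv hvx).pairwise v (hKs v)).imp_of_mem fun ha hb hab =>
        ⟨hmem' v hv hvx _ (hm _ hb) _ hab.1, hab.2⟩
  · intro u hu v hv huv
    by_cases hux : u = x
    · exact .inl (hux ▸ hxP v)
    by_cases hvx : v = x
    · exact .inr (hvx ▸ hxP u)
    have huK : u ∈ K v := by
      rw [hK]
      exact .single ⟨huv.symm, ⟨hv, hvx⟩, ⟨hu, hux⟩⟩
    exact ((hQP v hv hvx).edge u huK v (hKs v) huv).imp (hmem' v hv hvx v (hKs v) u)
      (hmem' v hv hvx u huK v)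
  · intro v hv
    by_cases hvx : v = x
    · subst hvx
      have : {w ∈ H | v ∈ P w} = H := by
        ext w
        simp [hxP]
      rwa [this]
    · have : {w ∈ H | v ∈ P w} = {w ∈ K v | v ∈ Q (K v) w} := by
        ext w
        constructor
        · rintro ⟨hw, hvw⟩
          obtain ⟨hwx, h₁, -, h₂, -⟩ := hmem w hw v hvw hvx
          rw [← h₂] at h₁
          exact ⟨h₂ ▸ hKs w, h₁⟩
        · rintro ⟨hw, hvw⟩
          exact ⟨(hKH v hv hvx w hw).1, hmem' v hv hvx w hw v hvw⟩
      rw [this]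
      exact (hQP v hv hvx).conn v (hKs v)
  · intro v hv
    by_cases hvx : v = x
    · simp [hvx, hPx]
    · simpa [hPn v hvx] using (hQP v hv hvx).length_le v (hKs v)
  · intro v hv hleaf
    by_cases hvx : v = x
    · subst hvx
      refine .inl ⟨?_, hPx⟩
      ext w
      exact ⟨fun hw => hleaf w hw (hxP w), fun hw => hw ▸ hv⟩
    · refine .inr ⟨K v, _, hKc v hv hvx, hPn v hvx, ?_⟩
      exact (hQP v hv hvx).leaf v (hKs v) fun w hw hvw =>
        hleaf w (hKH v hv hvx w hw).1 (hmem' v hv hvx w hw v hvw)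

/-- A list that splits into adjacent pairs, except that the last vertex may be left over, in
which case it is adjacent to the vertex preceding it. -/
inductive PairedPath {W : Type} (G : SimpleGraph W) : List W → Prop
  | single (v : W) : PairedPath G [v]
  | pair {x y : W} : G.Adj x y → PairedPath G [x, y]
  | cons {x y : W} {l : List W} : G.Adj x y → PairedPath G l → (∀ v, l = [v] → G.Adj y v) →
      PairedPath G (x :: y :: l)

theorem PairedPath.adj_get {W : Type} {G : SimpleGraph W} {l : List W} (h : PairedPath G l) :
    ∀ (j : ℕ) (hj : 2 * j + 1 < l.length), G.Adj l[2 * j] l[2 * j + 1] := by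
  induction h with
  | single v => intro j hj; simp at hj
  | pair h =>
    intro j hj
    obtain rfl : j = 0 := by simp at hj; omega
    simpa using h
  | cons h _ _ ih =>
    intro j hj
    rcases j with _ | j
    · simpa using h
    · have := ih j (by simp at hj; omega)
      simpa [Nat.mul_add] using this

theorem PairedPath.adj_last {W : Type} {G : SimpleGraph W} {l : List W} (h : PairedPath G l) :
    ∀ (j : ℕ) (hj : l.length = 2 * j + 3), G.Adj l[2 * j + 1] l[2 * j + 2] := by
  induction h with
  | single v => intro j hj; simp at hj
  | pair h => intro j hj; simp at hj
  | @cons x y l _ _ h ih =>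
    intro j hj
    rcases j with _ | j
    · obtain ⟨v, rfl⟩ := List.length_eq_one_iff.1 (by simpa using hj)
      simpa using h v rfl
    · have := ih j (by simp at hj; omega)
      simpa [Nat.mul_add] using this

theorem PairedPath.matchedList {W : Type} {G : SimpleGraph W} {l : List W}
    (h : PairedPath G l) (hl : 1 < l.length) : MatchedList G l := by
  rcases Nat.even_or_odd l.length with he | ho
  · exact .inl ⟨he, fun j hj => h.adj_get j hj⟩
  · obtain ⟨k, hk⟩ := ho
    obtain ⟨j, rfl⟩ : ∃ j, k = j + 1 := ⟨k - 1, by omega⟩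
    refine .inr ⟨⟨_, hk⟩, 2 * j + 1, ⟨j, rfl⟩, by omega, fun i hi => h.adj_get i (by omega), ?_⟩
    intro b hb
    obtain rfl : b = 0 := by omega
    exact h.adj_last j (by omega)

theorem EdgeElim.exists_isPathSystem {W : Type} {G : SimpleGraph W} {n : ℕ} {H : Set W}
    (h : EdgeElim G n H) (hH : ConnIn G H) :
    ∃ P, IsPathSystem G H P (2 * n) fun l => PairedPath G l ∧ ∀ v, l = [v] → H = {v} := by
  induction n generalizing H with
  | zero => exact h.elim
  | succ n ih =>
    obtain ⟨x, hx, h⟩ := h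
    obtain ⟨P, hP⟩ := exists_isPathSystem_of_components hH hx (b := 2 * n + 1)
      (good := fun _ l => PairedPath G (x :: l) ∧ l ≠ []) fun C hC => by
        obtain ⟨y, hy, hxy, h⟩ := h C hC
        obtain ⟨P, hP⟩ := exists_isPathSystem_of_components hC.connIn hy
          fun C' hC' => ih (h C' hC') hC'.connIn
        refine ⟨P, hP.imp ?_⟩
        rintro _ (⟨-, rfl⟩ | ⟨C', l, hC', rfl, hl, hs⟩)
        · exact ⟨.pair hxy, by simp⟩
        · refine ⟨.cons hxy hl fun v hv => ?_, by simp⟩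
          obtain ⟨z, hz, hyz⟩ := hC'.exists_adj hC.connIn hy
          rw [hs v hv] at hz
          exact hz ▸ hyz
    refine ⟨P, hP.imp ?_⟩
    rintro _ (⟨rfl, rfl⟩ | ⟨C, l, -, rfl, hl, hne⟩)
    · exact ⟨.single x, by simp⟩
    · exact ⟨hl, fun v hv => absurd (List.cons.inj hv).2 hne⟩

theorem EdgeElim.exists_isMatched {W : Type} [Fintype W] [Nontrivial W] {G : SimpleGraph W}
    {n : ℕ} (h : EdgeElim G n Set.univ) (hG : G.Connected) :
    ∃ T : ElimTree G, T.IsMatched ∧ T.depth ≤ 2 * n := by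
  obtain ⟨P, hP⟩ := h.exists_isPathSystem hG.connIn_univ
  let T : ElimTree G :=
    { anc := fun u v => u ∈ P v ∧ u ≠ v
      trans := by
        rintro a b c ⟨hab, hne⟩ ⟨hbc, -⟩
        refine ⟨hP.trans c trivial b hbc a hab, ?_⟩
        rintro rfl
        exact hne (hP.antisymm a trivial b trivial hab hbc)
      irrefl := fun a h => h.2 rfl
      chainAnc := by
        rintro a b c ⟨hac, -⟩ ⟨hbc, -⟩
        by_cases hab : a = b
        · exact .inl hab
        · exact .inr ((hP.chain c trivial a hac b hbc).imp (⟨·, hab⟩) (⟨·, Ne.symm hab⟩))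
      edgeComp := fun u v huv => (hP.edge u trivial v trivial huv).imp (⟨·, huv.ne⟩)
        (⟨·, huv.ne'⟩)
      subtreeConn := by
        intro v
        have hset : {w | w = v ∨ (v ∈ P w ∧ v ≠ w)} = {w ∈ Set.univ | v ∈ P w} := by
          ext w
          have := hP.self v trivial
          by_cases hw : w = v
          · simp [hw, this]
          · simp [hw, Ne.symm hw]
        rw [hset]
        exact (hP.conn v trivial).induce_connected ⟨v, trivial, hP.self v trivial⟩ }
  refine ⟨T, ?_, ?_⟩
  · intro v hv l hl hm
    have hlP : l = P v := by
      refine List.Perm.eq_of_pairwise (le := T.anc)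
        (fun a b _ _ hab hba => absurd (T.trans _ _ _ hab hba) (T.irrefl a))
        hl (hP.pairwise v trivial) ?_
      refine (List.perm_ext_iff_of_nodup (hl.imp And.right)
        ((hP.pairwise v trivial).imp And.right)).2 fun u => ?_
      have := hP.self v trivial
      rw [hm]
      by_cases huv : u = v
      · simp [huv, this]
      · simp [T, huv]
    rw [hlP]
    obtain ⟨hpp, hs⟩ := hP.leaf v trivial fun w _ hw => by
      by_contra hne
      exact hv w ⟨hw, Ne.symm hne⟩
    refine hpp.matchedList ?_
    by_contra hle
    have hpos := List.length_pos_of_mem (hP.self v trivial)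
    obtain ⟨w, hw⟩ := List.length_eq_one_iff.1 (by omega : (P v).length = 1)
    have := hs w hw
    exact Set.nontrivial_univ.ne_singleton this
  · refine Finset.sup_le fun v _ => ?_
    classical
    have hv : v ∈ {u | u ∈ P v} := hP.self v trivial
    have hset : {u | T.anc u v} = {u | u ∈ P v} \ {v} := rfl
    rw [hset, Set.ncard_sdiff_singleton_add_one hv]
    calc {u | u ∈ P v}.ncard = (P v).toFinset.card := by
          rw [← Set.ncard_coe_finset]
          simp
      _ ≤ (P v).length := List.toFinset_card_le _
      _ ≤ 2 * n := hP.length_le v trivial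

theorem exists_isMatched_depth_eq_mtd {V : Type} [Fintype V] [Nontrivial V] {G : SimpleGraph V}
    (hG : G.Connected) : ∃ T : ElimTree G, T.IsMatched ∧ T.depth = mtd G := by
  obtain ⟨T, hT, -⟩ := (edgeElim_of_ncard_le _ Set.univ le_rfl Set.univ_nonempty
    hG.connIn_univ).exists_isMatched hG
  exact Nat.sInf_mem (s := {d | ∃ T : ElimTree G, T.IsMatched ∧ T.depth = d}) ⟨_, T, hT, rfl⟩

theorem mtd_eq_zero_of_subsingleton {V : Type} [Fintype V] [Subsingleton V] [Nonempty V]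
    (G : SimpleGraph V) : mtd G = 0 := by
  have : {d | ∃ T : ElimTree G, T.IsMatched ∧ T.depth = d} = ∅ := by
    rw [Set.eq_empty_iff_forall_notMem]
    rintro _ ⟨T, hT, -⟩
    let v : V := Classical.arbitrary V
    have hanc : ∀ a b, ¬ T.anc a b := fun a b h => T.irrefl a (Subsingleton.elim b a ▸ h)
    rcases hT v (hanc v) [v] (by simp) (by simp [hanc]) with ⟨h, -⟩ | ⟨-, p, -, hp, -⟩
    · simp at h
    · simp at hp
  rw [mtd, this, Nat.sInf_empty]

theorem mtd_induce_le {V : Type} [Fintype V] {G : SimpleGraph V} (hG : G.Connected)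
    (S : Set V) [Fintype S] (hS : (G.induce S).Connected) {m : ℕ} (hm : mtd G ≤ 2 * m) :
    mtd (G.induce S) ≤ 2 * m := by
  have := hS.nonempty
  rcases subsingleton_or_nontrivial S with h | h
  · simp [mtd_eq_zero_of_subsingleton]
  · have : Nontrivial V := Subtype.val_injective.nontrivial (α := S)
    obtain ⟨T, hT, hd⟩ := exists_isMatched_depth_eq_mtd hG
    have hlev : ∀ v, T.level v + 1 ≤ 2 * m := fun v =>
      (Finset.le_sup (f := fun v => {u | T.anc u v}.ncard + 1) (Finset.mem_univ v)).trans
        (hd.le.trans hm)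
    obtain ⟨T', hT', hd'⟩ :=
      (hT.edgeElim_univ (Embedding.induce S) hlev hG hS).exists_isMatched hS
    exact (Nat.sInf_le (s := {d | ∃ T : ElimTree (G.induce S), T.IsMatched ∧ T.depth = d})
      ⟨T', hT', rfl⟩).trans hd'

/-- For a connected induced subgraph `G' = G.induce S` of a connected graph
`G`: if `mtd G` is even then `mtd G' ≤ mtd G`, and if `mtd G` is odd then
`mtd G' ≤ mtd G + 1`. -/
theorem stmt3 {V : Type} [Fintype V] (G : SimpleGraph V) (hG : G.Connected)
    (S : Set V) [Fintype S] (hS : (G.induce S).Connected) :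
    (Even (mtd G) → mtd (G.induce S) ≤ mtd G) ∧
    (Odd (mtd G) → mtd (G.induce S) ≤ mtd G + 1) := by
  constructor
  · rintro ⟨k, hk⟩
    have := mtd_induce_le hG S hS (m := k) (by omega)
    omega
  · rintro ⟨k, hk⟩
    have := mtd_induce_le hG S hS (m := k + 1) (by omega)
    omega
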